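/- arXiv:1302.1929 — 4 statements merged into one kernel-verified Lean document; each statement's English description precedes it below -/
import Mathlib

section
/- Let G be a finite group and H a proper nontrivial subgroup of G that is malnormal, i.e., H ∩ gHg⁻¹ = {1} for every g ∈ G \ H. Then |H| divides [G : H] − 1. -/
/-- A subgroup `H ≤ G` is malnormal if `H ∩ gHg⁻¹ = {1}` for every `g ∉ H`. -/
def IsMalnormal {G : Type} [Group G] (H : Subgroup G) : Prop :=
  ∀ g : G, g ∉ H → ∀ x : G, x ∈ H → g⁻¹ * x * g ∈ H → x = 1

theorem Nat.card_dvd_card_of_stabilizer_eq_bot {K X : Type*} [Group K] [MulAction K X]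
    (h : ∀ b : X, MulAction.stabilizer K b = ⊥) : Nat.card K ∣ Nat.card X := by
  rw [Nat.card_congr (MulAction.selfEquivOrbitsQuotientProd h), Nat.card_prod]
  exact dvd_mul_left _ _

open MulAction in
theorem Nat.card_stabilizer_dvd_card_sub_one {K X : Type*} [Group K] [MulAction K X] [Finite X]
    (a : X) (h : ∀ b ≠ a, ∀ k ∈ stabilizer K a, k • b = b → k = 1) :
    Nat.card (stabilizer K a) ∣ Nat.card X - 1 := by
  rw [← SubMulAction.nat_card_ofStabilizer_eq K a]
  refine Nat.card_dvd_card_of_stabilizer_eq_bot fun b ↦ eq_bot_iff.mpr fun k hk ↦ ?_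
  exact Subtype.ext (h b b.2 k k.2 (congrArg Subtype.val hk))

theorem IsMalnormal.eq_one_of_smul_eq {G : Type} [Group G] {H : Subgroup G}
    (hmal : IsMalnormal H) {q : G ⧸ H} (hq : q ≠ (1 : G)) {x : G} (hx : x ∈ H)
    (hxq : x • q = q) : x = 1 := by
  induction q using QuotientGroup.induction_on with
  | H g =>
    have hg : g ∉ H := fun hg ↦ hq (QuotientGroup.eq.mpr (by simpa using hg))
    have hfix : ((x * g : G) : G ⧸ H) = g := hxq
    refine hmal g hg x hx ?_
    simpa [mul_assoc] using QuotientGroup.eq.mp hfix.symm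

theorem stmt4 (G : Type) [Group G] [Fintype G] (H : Subgroup G)
    (hbot : H ≠ ⊥) (htop : H ≠ ⊤) (hmal : IsMalnormal H) :
    Nat.card H ∣ H.index - 1 := by
  have h := Nat.card_stabilizer_dvd_card_sub_one (K := G) ((1 : G) : G ⧸ H) fun b hb k hk ↦
    hmal.eq_one_of_smul_eq hb (by rwa [MulAction.stabilizer_quotient] at hk)
  rwa [MulAction.stabilizer_quotient] at h
end

section
/- Let G be a finite group, H a proper nontrivial malnormal abelian subgroup of G, and K a normal abelian subgroup of G with K ∩ H = {1} and K·H = G. Then: (i) for distinct x, y ∈ K one has xHx⁻¹ ∩ yHy⁻¹ = {1}; (ii) the map sending a ∈ H \ {1} to its conjugacy class aᴳ in G is injective, and each such conjugacy class has exactly |K| elements; (iii) these |H| − 1 conjugacy classes partition G \ K. -/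
open scoped Pointwise

section Malnormal

variable {G : Type} [Group G] {H K : Subgroup G}

/-- A nontrivial element of a malnormal subgroup `H` is conjugated into `H` by no nontrivial element
of a subgroup meeting `H` trivially. -/
theorem IsMalnormal.eq_one_of_conj_mem (hmal : IsMalnormal H) (hKH : K ⊓ H = ⊥) {k a : G}
    (hk : k ∈ K) (ha : a ∈ H) (ha1 : a ≠ 1) (h : k⁻¹ * a * k ∈ H) : k = 1 := by
  by_contra hk1
  refine ha1 (hmal k (fun hkH => hk1 ?_) a ha h)
  rw [← Subgroup.mem_bot, ← hKH]
  exact ⟨hk, hkH⟩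

theorem IsMalnormal.eq_of_conj_eq_conj (hmal : IsMalnormal H) (hKH : K ⊓ H = ⊥) {x y a b : G}
    (hx : x ∈ K) (hy : y ∈ K) (ha : a ∈ H) (hb : b ∈ H) (ha1 : a ≠ 1)
    (h : x * a * x⁻¹ = y * b * y⁻¹) : x = y := by
  refine inv_mul_eq_one.mp
    (hmal.eq_one_of_conj_mem hKH (K.mul_mem (K.inv_mem hx) hy) ha ha1 ?_)
  have : (x⁻¹ * y)⁻¹ * a * (x⁻¹ * y) = y⁻¹ * (x * a * x⁻¹) * y := by group
  rw [this, h]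
  convert hb using 1
  group

theorem exists_conj_of_isConj (hHab : ∀ a b : G, a ∈ H → b ∈ H → a * b = b * a)
    (hprod : (K : Set G) * (H : Set G) = Set.univ) {a y : G} (ha : a ∈ H) (h : IsConj a y) :
    ∃ k ∈ K, k * a * k⁻¹ = y := by
  obtain ⟨c, rfl⟩ := isConj_iff.mp h
  obtain ⟨k, hk, b, hb, rfl⟩ := Set.mem_mul.mp (hprod ▸ Set.mem_univ c)
  refine ⟨k, hk, ?_⟩
  have hab : b * a * b⁻¹ = a := by rw [hHab b a hb ha, mul_inv_cancel_right]
  calc k * a * k⁻¹ = k * (b * a * b⁻¹) * k⁻¹ := by rw [hab]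
    _ = k * b * a * (k * b)⁻¹ := by group

theorem IsMalnormal.eq_of_isConj (hmal : IsMalnormal H)
    (hHab : ∀ a b : G, a ∈ H → b ∈ H → a * b = b * a) (hKH : K ⊓ H = ⊥)
    (hprod : (K : Set G) * (H : Set G) = Set.univ) {a b : G} (ha : a ∈ H) (hb : b ∈ H)
    (ha1 : a ≠ 1) (h : IsConj a b) : a = b := by
  obtain ⟨k, hk, hkab⟩ := exists_conj_of_isConj hHab hprod ha h
  have hk1 : k = 1 :=
    hmal.eq_of_conj_eq_conj hKH hk K.one_mem ha hb ha1 (by simpa using hkab)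
  simpa [hk1] using hkab

theorem IsMalnormal.card_isConj (hmal : IsMalnormal H)
    (hHab : ∀ a b : G, a ∈ H → b ∈ H → a * b = b * a) (hKH : K ⊓ H = ⊥)
    (hprod : (K : Set G) * (H : Set G) = Set.univ) {a : G} (ha : a ∈ H) (ha1 : a ≠ 1) :
    Nat.card {y : G | IsConj a y} = Nat.card K := by
  have himage : {y : G | IsConj a y} = (fun k => k * a * k⁻¹) '' (K : Set G) := by
    ext y
    constructor
    · exact exists_conj_of_isConj hHab hprod ha
    · rintro ⟨k, -, rfl⟩
      exact isConj_iff.mpr ⟨k, rfl⟩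
  rw [himage]
  exact Nat.card_image_of_injOn fun x hx y hy h => hmal.eq_of_conj_eq_conj hKH hx hy ha ha ha1 h

/-- If `K` is a finite normal subgroup, every element of the coset `K * a` is a conjugate of `a`. -/
theorem IsMalnormal.isConj_mul_left [Finite K] (hmal : IsMalnormal H) (hKnorm : K.Normal)
    (hKH : K ⊓ H = ⊥) {k a : G} (hk : k ∈ K) (ha : a ∈ H) (ha1 : a ≠ 1) : IsConj a (k * a) := by
  let f : K → K := fun x => ⟨x * (a * (x : G)⁻¹ * a⁻¹),
    K.mul_mem x.2 (hKnorm.conj_mem _ (K.inv_mem x.2) a)⟩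
  have hf : Function.Injective f := fun x y hxy => Subtype.ext <| by
    refine hmal.eq_of_conj_eq_conj hKH x.2 y.2 ha ha ha1 ?_
    simpa [f, ← mul_assoc] using congrArg Subtype.val hxy
  obtain ⟨x, hx⟩ := Finite.surjective_of_injective hf ⟨k, hk⟩
  refine isConj_iff.mpr ⟨x, ?_⟩
  have hxk : (x : G) * (a * (x : G)⁻¹ * a⁻¹) = k := congrArg Subtype.val hx
  rw [← hxk]
  group

theorem IsMalnormal.iUnion_isConj [Finite K] (hmal : IsMalnormal H) (hKnorm : K.Normal)
    (hKH : K ⊓ H = ⊥) (hprod : (K : Set G) * (H : Set G) = Set.univ) :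
    (⋃ a ∈ {a : G | a ∈ H ∧ a ≠ 1}, {y : G | IsConj a y}) = {g : G | g ∉ K} := by
  ext g
  simp only [Set.mem_iUnion, Set.mem_ofPred_eq, exists_prop]
  constructor
  · rintro ⟨a, ⟨ha, ha1⟩, hag⟩ hg
    obtain ⟨c, rfl⟩ := isConj_iff.mp hag
    refine ha1 ?_
    rw [← Subgroup.mem_bot, ← hKH]
    exact ⟨by simpa [mul_assoc] using hKnorm.conj_mem _ hg c⁻¹, ha⟩
  · intro hg
    obtain ⟨k, hk, a, ha, rfl⟩ := Set.mem_mul.mp (hprod ▸ Set.mem_univ g)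
    have ha1 : a ≠ 1 := by
      rintro rfl
      exact hg (by simpa using hk)
    exact ⟨a, ⟨ha, ha1⟩, hmal.isConj_mul_left hKnorm hKH hk ha ha1⟩

theorem IsMalnormal.card_conjClasses [Finite H] (hmal : IsMalnormal H)
    (hHab : ∀ a b : G, a ∈ H → b ∈ H → a * b = b * a) (hKH : K ⊓ H = ⊥)
    (hprod : (K : Set G) * (H : Set G) = Set.univ) :
    Nat.card {C : ConjClasses G | ∃ a ∈ H, a ≠ 1 ∧ C = ConjClasses.mk a} = Nat.card H - 1 := by
  have himage : {C : ConjClasses G | ∃ a ∈ H, a ≠ 1 ∧ C = ConjClasses.mk a} =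
      ConjClasses.mk '' ((H : Set G) \ {1}) := by
    ext C
    simp [and_assoc, eq_comm]
  rw [himage, Nat.card_image_of_injOn]
  · exact Set.ncard_sdiff_singleton_of_mem H.one_mem
  · rintro a ⟨ha, ha1⟩ b ⟨hb, -⟩ h
    exact hmal.eq_of_isConj hHab hKH hprod ha hb ha1 (ConjClasses.mk_eq_mk_iff_isConj.mp h)

end Malnormal

theorem stmt6 (G : Type) [Group G] [Fintype G] (H K : Subgroup G)
    (hHbot : H ≠ ⊥) (hHtop : H ≠ ⊤) (hmal : IsMalnormal H)
    (hHab : ∀ a b : G, a ∈ H → b ∈ H → a * b = b * a)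
    (hKnorm : K.Normal)
    (hKab : ∀ a b : G, a ∈ K → b ∈ K → a * b = b * a)
    (hKH : K ⊓ H = ⊥) (hprod : (K : Set G) * (H : Set G) = Set.univ) :
    -- (i) conjugates of `H` by distinct elements of `K` intersect trivially
    (∀ x ∈ K, ∀ y ∈ K, x ≠ y →
        ∀ z : G, (∃ a ∈ H, z = x * a * x⁻¹) → (∃ b ∈ H, z = y * b * y⁻¹) → z = 1)
      -- (ii) the conjugacy-class map is injective on `H \ {1}`, classes have size `|K|`
      ∧ (∀ a ∈ H, ∀ b ∈ H, a ≠ 1 → b ≠ 1 →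
          ConjClasses.mk a = ConjClasses.mk b → a = b)
      ∧ (∀ a ∈ H, a ≠ 1 → Nat.card {y : G | IsConj a y} = Nat.card K)
      -- (iii) these |H| - 1 conjugacy classes partition `G \ K`
      ∧ (⋃ a ∈ {a : G | a ∈ H ∧ a ≠ 1}, {y : G | IsConj a y}) = {g : G | g ∉ K}
      ∧ Nat.card {C : ConjClasses G | ∃ a ∈ H, a ≠ 1 ∧ C = ConjClasses.mk a}
          = Nat.card H - 1 := by
  refine ⟨?_, fun a ha b hb ha1 _ h => hmal.eq_of_isConj hHab hKH hprod ha hb ha1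
      (ConjClasses.mk_eq_mk_iff_isConj.mp h),
    fun a ha ha1 => hmal.card_isConj hHab hKH hprod ha ha1,
    hmal.iUnion_isConj hKnorm hKH hprod, hmal.card_conjClasses hHab hKH hprod⟩
  rintro x hx y hy hxy z ⟨a, ha, rfl⟩ ⟨b, hb, hab⟩
  by_contra hz
  refine hxy (hmal.eq_of_conj_eq_conj hKH hx hy ha hb ?_ hab)
  rintro rfl
  exact hz (by simp)
end

section
/- Let G be a finite group, H a proper nontrivial malnormal abelian subgroup of G, and K a normal abelian subgroup of G with K ∩ H = {1} and K·H = G, and set h = |H|. Then G has exactly h linear (degree-one) irreducible complex characters, and every irreducible complex character of G of degree greater than 1 has degree exactly h. -/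
open scoped Pointwise

/-- `χ : G → ℂ` is an irreducible (complex) character of `G`. -/
def IsIrrChar (G : Type) [Group G] (χ : G → ℂ) : Prop :=
  ∃ V : FDRep ℂ G, CategoryTheory.Simple V ∧ χ = V.character

/-- A finite commutative group acting on a nonzero finite-dimensional complex vector space has a
common eigenvector, and the eigenvalues form a character. -/
theorem exists_eigencharacter {A V : Type*} [Group A] [Finite A] [AddCommGroup V] [Module ℂ V]
    [FiniteDimensional ℂ V] [Nontrivial V] (hA : ∀ a b : A, a * b = b * a)
    (ρ : Representation ℂ A V) :
    ∃ (ψ : A →* ℂ) (v : V), v ≠ 0 ∧ ∀ a, ρ a v = ψ a • v := by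
  have hss (a : A) : Module.End.IsSemisimple (ρ a) := by
    refine Module.End.isSemisimple_of_squarefree_aeval_eq_zero
      (p := Polynomial.X ^ Nat.card A - 1) ?_ ?_
    · exact (Polynomial.X_pow_sub_one_separable_iff.mpr
        (by exact_mod_cast Nat.card_pos.ne')).squarefree
    · rw [map_sub, map_pow, Polynomial.aeval_X, ← map_pow, pow_card_eq_one', map_one, map_one,
        sub_self]
  have htop :=
    Module.End.iSup_iInf_maxGenEigenspace_eq_top_of_iSup_maxGenEigenspace_eq_top_of_commute
    ρ (fun a b _ => by
      change ρ a * ρ b = ρ b * ρ a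
      rw [← map_mul, hA, map_mul])
    (fun a => Module.End.iSup_maxGenEigenspace_eq_top (ρ a))
  obtain ⟨μ, hμ⟩ : ∃ μ : A → ℂ, (⨅ a, Module.End.maxGenEigenspace (ρ a) (μ a)) ≠ ⊥ := by
    by_contra! h
    simp [h] at htop
  obtain ⟨v, hv, hv0⟩ := Submodule.exists_mem_ne_zero_of_ne_bot hμ
  have hv' (a : A) : ρ a v = μ a • v := by
    have := (Submodule.mem_iInf _).mp hv a
    rw [(hss a).isFinitelySemisimple.maxGenEigenspace_eq_eigenspace] at this
    exact Module.End.mem_eigenspace_iff.mp this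
  refine ⟨⟨⟨μ, ?_⟩, fun a b => ?_⟩, v, hv0, hv'⟩
  · refine smul_left_injective ℂ hv0 ?_
    simp [← hv']
  · refine smul_left_injective ℂ hv0 ?_
    change μ (a * b) • v = (μ a * μ b) • v
    rw [← hv', map_mul, Module.End.mul_apply, hv' b, map_smul, hv' a, smul_smul, mul_comm]

theorem nontrivial_of_simple {G : Type} [Group G] (V : FDRep ℂ G) [CategoryTheory.Simple V] :
    Nontrivial V := by
  by_contra h
  rw [not_nontrivial_iff_subsingleton] at h
  refine CategoryTheory.id_nonzero V ?_
  ext v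
  exact Subsingleton.elim (α := V) _ _

/-- An invariant subspace of a simple representation is trivial or everything. -/
theorem eq_bot_or_eq_top_of_simple {G : Type} [Group G] (V : FDRep ℂ G) [CategoryTheory.Simple V]
    (W : Submodule ℂ V) (hW : ∀ g, ∀ w ∈ W, V.ρ g w ∈ W) : W = ⊥ ∨ W = ⊤ := by
  let σ : Subrepresentation V.ρ := ⟨W, fun g w hw => hW g w hw⟩
  let f : FDRep.of σ.toRepresentation ⟶ V :=
    ⟨CategoryTheory.InducedCategory.homMk (ModuleCat.ofHom W.subtype), fun g => by ext; rfl⟩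
  have hf : CategoryTheory.Mono f := by
    apply (CategoryTheory.forget (FDRep ℂ G)).mono_of_mono_map
    rw [CategoryTheory.mono_iff_injective]
    exact Subtype.val_injective
  by_cases h0 : f = 0
  · left
    rw [eq_bot_iff]
    intro w hw
    have := congrArg (fun φ : FDRep.of σ.toRepresentation ⟶ V => φ.hom.hom.hom ⟨w, hw⟩) h0
    exact this
  · right
    have : CategoryTheory.IsIso f := CategoryTheory.isIso_of_mono_of_nonzero h0
    rw [eq_top_iff]
    intro w _
    let e := FDRep.isoToLinearEquiv (CategoryTheory.asIso f)
    have hw : e (e.symm w) = w := e.apply_symm_apply w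
    rw [← hw]
    exact (e.symm w).2

/-- The irreducible characters of degree one are exactly the homomorphisms to `ℂˣ`. -/
theorem setOf_linear_irrChar_eq_range (G : Type) [Group G] [Fintype G] :
    {χ : G → ℂ | IsIrrChar G χ ∧ χ 1 = 1} =
      Set.range fun (f : G →* ℂˣ) (g : G) => (f g : ℂ) := by
  ext χ
  constructor
  · rintro ⟨⟨V, hV, rfl⟩, h1⟩
    rw [FDRep.char_one] at h1
    have h1 : Module.finrank ℂ V = 1 := by exact_mod_cast h1
    have hnt := nontrivial_of_simple V
    have hscalar (f : Module.End ℂ V) : ∃ c : ℂ, c • (1 : Module.End ℂ V) = f :=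
      (finrank_eq_one_iff_of_nonzero' _ one_ne_zero).mp
        (by rw [Module.finrank_linearMap, h1]) f
    let χ : G →* ℂ :=
      { toFun := V.character
        map_one' := by simp [h1]
        map_mul' := fun a b => by
          obtain ⟨c, hc⟩ := hscalar (V.ρ a)
          obtain ⟨d, hd⟩ := hscalar (V.ρ b)
          simp only [FDRep.character, map_mul, ← hc, ← hd]
          simp [h1, mul_comm] }
    exact ⟨χ.toHomUnits, rfl⟩
  · rintro ⟨f, rfl⟩
    let ρ : Representation ℂ G ℂ :=
      (Algebra.lmul ℂ ℂ).toRingHom.toMonoidHom.comp ((Units.coeHom ℂ).comp f)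
    have hchar : (fun g => (f g : ℂ)) = (FDRep.of ρ).character := by
      ext g
      change (f g : ℂ) = LinearMap.trace ℂ ℂ (LinearMap.mul ℂ ℂ (f g))
      rw [LinearMap.trace_eq_matrix_trace ℂ (Module.Basis.singleton Unit ℂ)]
      simp [Matrix.trace, LinearMap.toMatrix_apply]
    refine ⟨⟨FDRep.of ρ, ?_, hchar⟩, by simp⟩
    rw [FDRep.simple_iff_char_is_norm_one, ← hchar]
    simp

namespace IsMalnormal

variable {G : Type} [Group G] {H K : Subgroup G}

/-- Nontrivial elements of a malnormal subgroup act without fixed points on a subgroup meeting it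
trivially. -/
theorem eq_one_of_commute (hmal : IsMalnormal H) (hKH : K ⊓ H = ⊥) {h k : G} (hh : h ∈ H)
    (h1 : h ≠ 1) (hk : k ∈ K) (hc : h * k = k * h) : k = 1 := by
  by_contra hk1
  refine h1 (hmal k (fun hkH => hk1 ?_) h hh (by rwa [mul_assoc, hc, inv_mul_cancel_left]))
  have : k ∈ K ⊓ H := ⟨hk, hkH⟩
  simpa [hKH] using this

/-- If a finite group has a malnormal subgroup containing `h ≠ 1`, every element of a normal
subgroup `K` meeting it trivially is a commutator `h⁻¹ k h k⁻¹`. -/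
theorem exists_commutator [Finite G] (hmal : IsMalnormal H) (hKnorm : K.Normal)
    (hKH : K ⊓ H = ⊥) {h : G} (hh : h ∈ H)
    (h1 : h ≠ 1) {x : G} (hx : x ∈ K) : ∃ k ∈ K, x = h⁻¹ * k * h * k⁻¹ := by
  have hconj (k : G) (hk : k ∈ K) : h⁻¹ * k * h ∈ K := by
    simpa using hKnorm.conj_mem k hk h⁻¹
  let φ : K → K := fun k => ⟨h⁻¹ * k * h * (k : G)⁻¹, K.mul_mem (hconj k k.2) (K.inv_mem k.2)⟩
  have hφ : Function.Injective φ := by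
    intro a b hab
    have hab : h⁻¹ * a * h * (a : G)⁻¹ = h⁻¹ * b * h * (b : G)⁻¹ := congrArg Subtype.val hab
    have key : h * ((b : G)⁻¹ * a) = (b : G)⁻¹ * a * h := by
      have hconj_eq : h⁻¹ * a * h = h⁻¹ * b * h * (b : G)⁻¹ * a := by rw [← hab]; group
      have hquot : (h⁻¹ * b * h)⁻¹ * (h⁻¹ * a * h) = (b : G)⁻¹ * a := by
        rw [hconj_eq]; group
      calc h * ((b : G)⁻¹ * a) = h * ((h⁻¹ * b * h)⁻¹ * (h⁻¹ * a * h)) := by rw [hquot]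
        _ = (b : G)⁻¹ * a * h := by group
    have := hmal.eq_one_of_commute hKH hh h1 (K.mul_mem (K.inv_mem b.2) a.2) key
    exact Subtype.ext (inv_mul_eq_one.mp this).symm
  obtain ⟨k, hk⟩ := Finite.surjective_of_injective hφ ⟨x, hx⟩
  exact ⟨k, k.2, (congrArg Subtype.val hk).symm⟩

end IsMalnormal

/-- Restriction identifies the linear characters of a Frobenius group with those of the
complement. -/
theorem bijective_restrict_monoidHom {G : Type} [Group G] [Finite G] {H K : Subgroup G}
    (hHbot : H ≠ ⊥) (hmal : IsMalnormal H) (hKnorm : K.Normal)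
    (hKH : K ⊓ H = ⊥) (hprod : (K : Set G) * (H : Set G) = Set.univ) :
    Function.Bijective fun f : G →* ℂˣ => f.comp H.subtype := by
  obtain ⟨h, hh, h1⟩ := H.bot_or_exists_ne_one.resolve_left hHbot
  have hdecomp (g : G) : ∃ k ∈ K, ∃ h ∈ H, k * h = g := by
    have : g ∈ (K : Set G) * (H : Set G) := hprod ▸ Set.mem_univ g
    exact Set.mem_mul.mp this
  constructor
  · have hK (f : G →* ℂˣ) (x : G) (hx : x ∈ K) : f x = 1 := by
      obtain ⟨k, -, rfl⟩ := hmal.exists_commutator hKnorm hKH hh h1 hx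
      simp [mul_comm]
    intro f f' hff
    ext1 g
    obtain ⟨k, hk, y, hy, rfl⟩ := hdecomp g
    rw [map_mul, map_mul, hK f k hk, hK f' k hk]
    exact congrArg (1 * ·) (DFunLike.congr_fun hff ⟨y, hy⟩)
  · intro f
    have hc : H.IsComplement' K :=
      (Subgroup.isComplement'_of_disjoint_and_mul_eq_univ (disjoint_iff.mpr hKH) hprod).symm
    refine ⟨(f.comp hc.QuotientMulEquiv.toMonoidHom).comp (QuotientGroup.mk' K), ?_⟩
    ext y : 1
    refine congrArg f ?_
    exact hc.QuotientMulEquiv.apply_symm_apply y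

open Module in
/-- An irreducible representation of a Frobenius group in which the kernel has a nonzero fixed
vector has dimension one. -/
theorem finrank_eq_one_of_fixed {G : Type} [Group G] [Finite G] {H K : Subgroup G}
    (hHab : ∀ a b : G, a ∈ H → b ∈ H → a * b = b * a) (hKnorm : K.Normal)
    (hprod : (K : Set G) * (H : Set G) = Set.univ)
    (V : FDRep ℂ G) [CategoryTheory.Simple V] {v : V} (hv : v ≠ 0)
    (hfix : ∀ k ∈ K, V.ρ k v = v) : finrank ℂ V = 1 := by
  have := nontrivial_of_simple V
  have hmul (a b : G) (w : V) : V.ρ (a * b) w = V.ρ a (V.ρ b w) := by simp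
  let W : Submodule ℂ V :=
    { carrier := {w | ∀ k ∈ K, V.ρ k w = w}
      add_mem' := fun ha hb k hk => by rw [map_add, ha k hk, hb k hk]
      zero_mem' := fun k _ => map_zero _
      smul_mem' := fun c w hw k hk => by rw [map_smul, hw k hk] }
  have hW : W = ⊤ := by
    refine (eq_bot_or_eq_top_of_simple V W fun g w hw k hk => ?_).resolve_left fun h => hv ?_
    · have := hw _ (by simpa using hKnorm.conj_mem k hk g⁻¹ : g⁻¹ * k * g ∈ K)
      rw [← hmul, show k * g = g * (g⁻¹ * k * g) by group, hmul, this]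
    · have : v ∈ W := hfix
      simpa [h] using this
  have hK (k : G) (hk : k ∈ K) (w : V) : V.ρ k w = w :=
    (hW ▸ Submodule.mem_top : w ∈ W) k hk
  obtain ⟨ψ, u, hu, hψ⟩ := exists_eigencharacter (A := H)
    (fun a b => Subtype.ext (hHab a b a.2 b.2)) (V.ρ.comp H.subtype)
  have hspan : ℂ ∙ u = ⊤ := by
    refine (eq_bot_or_eq_top_of_simple V (ℂ ∙ u) fun g w hw => ?_).resolve_left (by simpa using hu)
    have : g ∈ (K : Set G) * (H : Set G) := hprod ▸ Set.mem_univ g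
    obtain ⟨k, hk, y, hy, rfl⟩ := Set.mem_mul.mp this
    obtain ⟨c, rfl⟩ := Submodule.mem_span_singleton.mp hw
    rw [hmul, hK k hk, map_smul]
    exact Submodule.smul_mem _ _ (Submodule.mem_span_singleton.mpr ⟨ψ ⟨y, hy⟩, (hψ ⟨y, hy⟩).symm⟩)
  rw [← finrank_top, ← hspan, finrank_span_singleton hu]

open Module in
/-- An irreducible representation of a Frobenius group in which the kernel has a nontrivial
eigencharacter has dimension the order of the complement. -/
theorem finrank_eq_card_of_eigencharacter_ne_one {G : Type} [Group G] [Finite G] {H K : Subgroup G}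
    (hmal : IsMalnormal H) (hKnorm : K.Normal)
    (hKH : K ⊓ H = ⊥) (hprod : (K : Set G) * (H : Set G) = Set.univ)
    (V : FDRep ℂ G) [CategoryTheory.Simple V] {v : V} (hv : v ≠ 0) (ψ : K →* ℂ)
    (hψ : ∀ k : K, V.ρ k v = ψ k • v) (hψ1 : ψ ≠ 1) : finrank ℂ V = Nat.card H := by
  have := Fintype.ofFinite H
  have hmul (a b : G) (w : V) : V.ρ (a * b) w = V.ρ a (V.ρ b w) := by simp
  let ψc : H → (K →* ℂ) := fun h => ψ.comp (MulAut.conjNormal (h : G)⁻¹).toMonoidHom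
  let b : H → V := fun h => V.ρ h v
  have hb0 (h : H) : b h ≠ 0 := fun h0 => hv <| by
    have : V.ρ (h : G)⁻¹ (b h) = v := by rw [← hmul]; simp
    rw [← this, h0, map_zero]
  have hb (h : H) (k : K) : V.ρ k (b h) = ψc h k • b h := by
    have := hψ (MulAut.conjNormal (h : G)⁻¹ k)
    rw [MulAut.conjNormal_apply] at this
    rw [← hmul, show (k : G) * h = h * ((h : G)⁻¹ * k * (h : G)⁻¹⁻¹) by group, hmul, this, map_smul]
    rfl
  have hinj : Function.Injective ψc := by
    intro x y hxy
    by_contra hne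
    refine hψ1 (MonoidHom.ext fun z => ?_)
    have hne' : (y : G)⁻¹ * x ≠ 1 := fun h => hne (Subtype.ext (inv_mul_eq_one.mp h).symm)
    obtain ⟨k, hk, hzk⟩ := hmal.exists_commutator hKnorm hKH
      (H.mul_mem (H.inv_mem y.2) x.2) hne' z.2
    let k' : K := ⟨k, hk⟩
    have hz : z = MulAut.conjNormal (x : G)⁻¹ (MulAut.conjNormal (y : G) k') * k'⁻¹ := by
      ext
      simp only [Subgroup.coe_mul, MulAut.conjNormal_apply, hzk, Subgroup.coe_inv, k']
      group
    have h2 : ψ (MulAut.conjNormal (x : G)⁻¹ (MulAut.conjNormal (y : G) k')) = ψ k' := by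
      have := DFunLike.congr_fun hxy (MulAut.conjNormal (y : G) k')
      simpa [ψc] using this
    rw [hz, map_mul, h2, ← map_mul, mul_inv_cancel, map_one, MonoidHom.one_apply]
  have hli : LinearIndependent ℂ b := by
    rw [Fintype.linearIndependent_iff]
    intro c hc h
    have hbasis (φ : Dual ℂ V) : c h * φ (b h) = 0 := by
      have hchars := (linearIndependent_monoidHom K ℂ).comp ψc hinj
      refine Fintype.linearIndependent_iff.mp hchars (fun x => c x * φ (b x)) ?_ h
      ext k
      have := congrArg (fun w => φ (V.ρ k w)) hc
      simpa [map_sum, hb, mul_assoc, mul_left_comm, mul_comm] using this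
    have : c h • b h = 0 :=
      (forall_dual_apply_eq_zero_iff ℂ _).mp fun φ => by simpa using hbasis φ
    exact (smul_eq_zero.mp this).resolve_right (hb0 h)
  have hspan : Submodule.span ℂ (Set.range b) = ⊤ := by
    refine (eq_bot_or_eq_top_of_simple V _ fun g w hw => ?_).resolve_left fun h => hb0 1 ?_
    · have hg : g ∈ (K : Set G) * (H : Set G) := hprod ▸ Set.mem_univ g
      obtain ⟨k, hk, y, hy, rfl⟩ := Set.mem_mul.mp hg
      induction hw using Submodule.span_induction with
      | mem w hw =>
        obtain ⟨x, rfl⟩ := hw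
        have : V.ρ (k * y) (b x) = ψc (⟨y, hy⟩ * x) ⟨k, hk⟩ • b (⟨y, hy⟩ * x) := by
          rw [← hb, hmul]
          exact congrArg _ (hmul _ _ _).symm
        rw [this]
        exact Submodule.smul_mem _ _ (Submodule.subset_span ⟨_, rfl⟩)
      | zero => simp
      | add _ _ _ _ h₁ h₂ => rw [map_add]; exact Submodule.add_mem _ h₁ h₂
      | smul _ _ _ h => rw [map_smul]; exact Submodule.smul_mem _ _ h
    · have : b 1 ∈ Submodule.span ℂ (Set.range b) := Submodule.subset_span ⟨1, rfl⟩
      simpa [h] using this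
  rw [finrank_eq_card_basis (Basis.mk hli hspan.ge), Nat.card_eq_fintype_card]

theorem stmt7 (G : Type) [Group G] [Fintype G] (H K : Subgroup G)
    (hHbot : H ≠ ⊥) (hHtop : H ≠ ⊤) (hmal : IsMalnormal H)
    (hHab : ∀ a b : G, a ∈ H → b ∈ H → a * b = b * a)
    (hKnorm : K.Normal)
    (hKab : ∀ a b : G, a ∈ K → b ∈ K → a * b = b * a)
    (hKH : K ⊓ H = ⊥) (hprod : (K : Set G) * (H : Set G) = Set.univ) :
    Nat.card {χ : G → ℂ | IsIrrChar G χ ∧ χ 1 = 1} = Nat.card H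
      ∧ ∀ χ : G → ℂ, IsIrrChar G χ → χ 1 ≠ 1 → χ 1 = (Nat.card H : ℂ) := by
  constructor
  · let _ : CommGroup H := { mul_comm := fun a b => Subtype.ext (hHab a b a.2 b.2) }
    have : NeZero (Monoid.exponent H) := ⟨Monoid.exponent_ne_zero_of_finite⟩
    rw [setOf_linear_irrChar_eq_range, Nat.card_range_of_injective fun f f' hff =>
        MonoidHom.ext fun g => Units.ext (congrFun hff g),
      Nat.card_congr (.ofBijective _
        (bijective_restrict_monoidHom hHbot hmal hKnorm hKH hprod))]
    exact CommGroup.card_monoidHom_of_hasEnoughRootsOfUnity H ℂ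
  · rintro _ ⟨V, hV, rfl⟩ hne
    have := nontrivial_of_simple V
    rw [FDRep.char_one] at hne ⊢
    obtain ⟨ψ, v, hv, hψ⟩ := exists_eigencharacter (A := K)
      (fun a b => Subtype.ext (hKab a b a.2 b.2)) (V.ρ.comp K.subtype)
    by_cases hψ1 : ψ = 1
    · refine absurd ?_ hne
      rw [finrank_eq_one_of_fixed hHab hKnorm hprod V hv fun k hk => ?_, Nat.cast_one]
      simpa [hψ1] using hψ ⟨k, hk⟩
    · rw [finrank_eq_card_of_eigencharacter_ne_one hmal hKnorm hKH hprod V hv ψ hψ hψ1]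
end

section
/- Let h and k be integers with h ≥ 2, k ≥ h + 1, and h dividing k − 1. Then ((h² − 1)/h)·(1 − (h − 1)/k)·(1 − 1/k) ≥ 2/3, with equality if and only if h = 2 and k = 3. -/
theorem stmt12 (h k : ℕ) (hh : 2 ≤ h) (hk : h + 1 ≤ k) (hdvd : h ∣ k - 1) :
    2 / 3 ≤ ((h : ℝ) ^ 2 - 1) / h * (1 - ((h : ℝ) - 1) / k) * (1 - 1 / (k : ℝ))
      ∧ (((h : ℝ) ^ 2 - 1) / h * (1 - ((h : ℝ) - 1) / k) * (1 - 1 / (k : ℝ)) = 2 / 3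
          ↔ h = 2 ∧ k = 3) := by
  obtain ⟨n, rfl⟩ := Nat.exists_eq_add_of_le hh
  obtain ⟨m, rfl⟩ := Nat.exists_eq_add_of_le hk
  have hn : (0 : ℝ) ≤ n := n.cast_nonneg
  have hm : (0 : ℝ) ≤ m := m.cast_nonneg
  push_cast
  have key : ((2 + n : ℝ) ^ 2 - 1) / (2 + n) * (1 - ((2 + n : ℝ) - 1) / (2 + n + 1 + m))
      * (1 - 1 / (2 + n + 1 + m : ℝ)) = 2 / 3 +
      (4 * n * (n + 2) * (n + 3) + m * ((n + 3) * (3 * n ^ 2 + 11 * n + 4))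
        + m ^ 2 * (3 * n ^ 2 + 10 * n + 5)) / (3 * (2 + n) * (2 + n + 1 + m) ^ 2) := by
    have h₁ : (2 + n : ℝ) ≠ 0 := by positivity
    have h₂ : (2 + n + 1 + m : ℝ) ≠ 0 := by positivity
    field_simp
    ring
  rw [key]
  refine ⟨le_add_of_nonneg_right (by positivity), fun heq => ?_, ?_⟩
  · by_contra hne
    have hpos : (0 : ℝ) < 4 * n * (n + 2) * (n + 3) + m * ((n + 3) * (3 * n ^ 2 + 11 * n + 4))
        + m ^ 2 * (3 * n ^ 2 + 10 * n + 5) := by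
      rcases Nat.eq_zero_or_pos n with rfl | hn'
      · have hm' : (0 : ℝ) < m := by
          exact_mod_cast (by omega : 0 < m)
        positivity
      · have hn' : (0 : ℝ) < n := by exact_mod_cast hn'
        positivity
    have := div_pos hpos (by positivity : (0 : ℝ) < 3 * (2 + n) * (2 + n + 1 + m) ^ 2)
    linarith
  · rintro ⟨h₁, h₂⟩
    obtain rfl : n = 0 := by omega
    obtain rfl : m = 0 := by omega
    simp
end
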